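/- If n ≥ 3, n ≠ 7, S ⊆ {1,...,n-1}, |S| ≥ 2, and 1 ∈ S, then the circulant digraph C_n(S) has a strong 2-partition. -/

import Mathlib

/-!
Common definitions: digraphs as adjacency relations, directed walks and paths,
arc-colourings, proper connection and proper-walk connection numbers,
strong digraphs, bipartite digraphs, Hamiltonian cycles, chords,
circulant digraphs and strong 2-partitions.
-/

namespace PCDigraph

variable {V : Type*}

/-- A directed walk from `u` to `v` in the digraph with adjacency relation `Adj`. -/
inductive DWalk (Adj : V → V → Prop) : V → V → Type _
  | nil {v : V} : DWalk Adj v v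
  | cons {u v w : V} (h : Adj u v) (p : DWalk Adj v w) : DWalk Adj u w

namespace DWalk

variable {Adj : V → V → Prop}

/-- The list of arcs of a directed walk. -/
def arcs : ∀ {u v : V}, DWalk Adj u v → List (V × V)
  | _, _, .nil => []
  | u, _, .cons (v := w) _ p => (u, w) :: p.arcs

/-- The list of vertices visited by a directed walk. -/
def support : ∀ {u v : V}, DWalk Adj u v → List V
  | u, _, .nil => [u]
  | u, _, .cons _ p => u :: p.support

/-- A directed walk is a (directed) path if it visits no vertex twice. -/
def IsPath {u v : V} (p : DWalk Adj u v) : Prop := p.support.Nodup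

end DWalk

/-- A directed walk is properly coloured under the arc-colouring `c` if no two
consecutive arcs of the walk receive the same colour. -/
def ProperlyColoured {Adj : V → V → Prop} (c : V → V → ℕ) {u v : V}
    (p : DWalk Adj u v) : Prop :=
  (p.arcs.map fun e => c e.1 e.2).Chain' (· ≠ ·)

/-- `c` is an arc-colouring using colours in `{1, …, k}` that makes the digraph
properly connected: between every ordered pair of distinct vertices there is a
properly coloured directed path. -/
def IsPCColouring (Adj : V → V → Prop) (k : ℕ) (c : V → V → ℕ) : Prop :=
  (∀ u v : V, Adj u v → c u v ∈ Finset.Icc 1 k) ∧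
    ∀ u v : V, u ≠ v → ∃ p : DWalk Adj u v, p.IsPath ∧ ProperlyColoured c p

/-- `c` is an arc-colouring using colours in `{1, …, k}` that makes the digraph
properly-walk connected: between every ordered pair of distinct vertices there
is a properly coloured directed walk. -/
def IsWCColouring (Adj : V → V → Prop) (k : ℕ) (c : V → V → ℕ) : Prop :=
  (∀ u v : V, Adj u v → c u v ∈ Finset.Icc 1 k) ∧
    ∀ u v : V, u ≠ v → ∃ p : DWalk Adj u v, ProperlyColoured c p

/-- The proper connection number of a digraph. -/
noncomputable def pc (Adj : V → V → Prop) : ℕ :=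
  sInf {k : ℕ | ∃ c : V → V → ℕ, IsPCColouring Adj k c}

/-- The proper-walk connection number of a digraph. -/
noncomputable def wc (Adj : V → V → Prop) : ℕ :=
  sInf {k : ℕ | ∃ c : V → V → ℕ, IsWCColouring Adj k c}

/-- A digraph is strong if for every ordered pair of vertices there is a
directed path from the first to the second. -/
def Strong (Adj : V → V → Prop) : Prop :=
  ∀ u v : V, ∃ p : DWalk Adj u v, p.IsPath

/-- A digraph is bipartite if its vertex set can be partitioned into two sets
such that every arc joins vertices from different sets. -/
def Bipartite (Adj : V → V → Prop) : Prop :=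
  ∃ V₁ V₂ : Set V, V₁ ∪ V₂ = Set.univ ∧ Disjoint V₁ V₂ ∧
    ∀ u v : V, Adj u v → (u ∈ V₁ ∧ v ∈ V₂) ∨ (u ∈ V₂ ∧ v ∈ V₁)

/-- The out-degree of a vertex: the number of arcs with tail at that vertex. -/
noncomputable def outDeg (Adj : V → V → Prop) (v : V) : ℕ := {w | Adj v w}.ncard

/-- The in-degree of a vertex: the number of arcs with head at that vertex. -/
noncomputable def inDeg (Adj : V → V → Prop) (v : V) : ℕ := {w | Adj w v}.ncard

/-- `x` enumerates a Hamiltonian cycle of the digraph: it is a bijective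
enumeration of the vertices, consecutive vertices (cyclically) being joined
by an arc. -/
def IsHamCycle [Fintype V] (Adj : V → V → Prop)
    (x : ZMod (Fintype.card V) → V) : Prop :=
  Function.Bijective x ∧ ∀ i : ZMod (Fintype.card V), Adj (x i) (x (i + 1))

/-- A digraph is Hamiltonian if it has a Hamiltonian cycle. -/
def Hamiltonian [Fintype V] (Adj : V → V → Prop) : Prop :=
  ∃ x : ZMod (Fintype.card V) → V, IsHamCycle Adj x

/-- For a Hamiltonian cycle enumerated by `x`, the arc `x p → x q` is a chord
if it is not an arc of the cycle, i.e. `q ≠ p + 1`. -/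
def IsChord [Fintype V] (Adj : V → V → Prop)
    (x : ZMod (Fintype.card V) → V) (p q : ZMod (Fintype.card V)) : Prop :=
  Adj (x p) (x q) ∧ q ≠ p + 1

/-- The length of the chord from `x p` to `x q`: the length of the directed
path from `x p` to `x q` along the cycle. -/
def chordLength [Fintype V] (p q : ZMod (Fintype.card V)) : ℕ := (q - p).val

/-- The circulant digraph `C_n(S)`, with vertex set `ZMod n` and an arc from
`i` to `j` whenever `j - i ≡ s (mod n)` for some `s ∈ S`. -/
def circulantAdj (n : ℕ) (S : Finset ℕ) : ZMod n → ZMod n → Prop :=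
  fun i j => ∃ s ∈ S, j - i = (s : ZMod n)

/-- A strong 2-partition of a digraph: a partition of the vertex set into two
parts such that the spanning bipartite subdigraph induced by the arcs having
one end in each part is strong. -/
def HasStrongTwoPartition (Adj : V → V → Prop) : Prop :=
  ∃ V₁ V₂ : Set V, V₁ ∪ V₂ = Set.univ ∧ Disjoint V₁ V₂ ∧
    Strong (fun u v => Adj u v ∧ ((u ∈ V₁ ∧ v ∈ V₂) ∨ (u ∈ V₂ ∧ v ∈ V₁)))

end PCDigraph

open PCDigraph

namespace PCDigraph

section Paths

variable {V : Type*} {Adj : V → V → Prop}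

lemma DWalk.IsPath.exists_of_mem_support {v w : V} (p : DWalk Adj v w) (hp : p.IsPath) {u : V}
    (hu : u ∈ p.support) : ∃ q : DWalk Adj u w, q.IsPath := by
  induction p with
  | nil =>
    simp only [DWalk.support, List.mem_singleton] at hu
    subst hu
    exact ⟨.nil, hp⟩
  | cons h p ih =>
    simp only [DWalk.support, List.mem_cons] at hu
    rcases hu with rfl | hu
    · exact ⟨.cons h p, hp⟩
    · exact ih (List.nodup_cons.mp hp).2 hu

lemma exists_isPath_of_reflTransGen {u v : V} (h : Relation.ReflTransGen Adj u v) :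
    ∃ p : DWalk Adj u v, p.IsPath := by
  induction h using Relation.ReflTransGen.head_induction_on with
  | refl => exact ⟨.nil, List.nodup_singleton _⟩
  | @head a c hac _ ih =>
    obtain ⟨p, hp⟩ := ih
    by_cases ha : a ∈ p.support
    · exact hp.exists_of_mem_support p ha
    · exact ⟨.cons hac p, List.nodup_cons.mpr ⟨ha, hp⟩⟩

end Paths

/-- The vertices `i` of `ZMod n` for which `i + ⌊t * i / n⌋` is even. -/
def evenPart (n : ℕ) (t : ℤ) : Set (ZMod n) :=
  {v | ∃ i : ℤ, (i : ZMod n) = v ∧ Even (i + t * i / n)}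

/-- The arcs of the circulant digraph between `evenPart n t` and its complement. -/
def crossAdj (n : ℕ) (S : Finset ℕ) (t : ℤ) (u v : ZMod n) : Prop :=
  circulantAdj n S u v ∧ ((u ∈ evenPart n t ∧ v ∈ (evenPart n t)ᶜ) ∨
    (u ∈ (evenPart n t)ᶜ ∧ v ∈ evenPart n t))

variable {n : ℕ} {S : Finset ℕ} {t : ℤ}

lemma intCast_mem_evenPart (hn : 0 < n) (hnt : Even (n + t)) (i : ℤ) :
    (i : ZMod n) ∈ evenPart n t ↔ Even (i + t * i / n) := by
  refine ⟨?_, fun h => ⟨i, rfl, h⟩⟩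
  rintro ⟨j, hj, hev⟩
  obtain ⟨k, hk⟩ := (ZMod.intCast_eq_intCast_iff_dvd_sub j i n).mp hj
  obtain rfl : i = j + n * k := by linarith
  have hdiv : t * (j + n * k) / n = t * j / n + t * k := by
    rw [show t * (j + n * k) = t * j + n * (t * k) by ring,
      Int.add_mul_ediv_left _ _ (by omega)]
  rw [hdiv, show j + n * k + (t * j / n + t * k) = (j + t * j / n) + (n + t) * k by ring]
  exact hev.add (hnt.mul_right k)

lemma crossAdj_of_odd (hn : 0 < n) (hnt : Even (n + t)) {s : ℕ} (hs : s ∈ S) {σ : ℤ}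
    (hσ : (σ : ZMod n) = s) {i e : ℤ} (he : t * (i + σ) / n = t * i / n + e)
    (hodd : Odd (σ + e)) : crossAdj n S t i ((i + σ : ℤ) : ZMod n) := by
  refine ⟨⟨s, hs, by push_cast; rw [hσ]; ring⟩, ?_⟩
  simp only [Set.mem_compl_iff, intCast_mem_evenPart hn hnt, he]
  rw [show i + σ + (t * i / n + e) = (i + t * i / n) + (σ + e) by ring,
    Int.even_add (n := σ + e), ← Int.not_odd_iff_even (n := σ + e)]
  tauto

lemma crossAdj_succ (hn : 0 < n) (hnt : Even (n + t)) (h1 : 1 ∈ S) {i : ℤ}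
    (he : t * (i + 1) / n = t * i / n) : crossAdj n S t i ((i + 1 : ℤ) : ZMod n) :=
  crossAdj_of_odd hn hnt h1 (σ := 1) (e := 0) (by simp) (by simpa using he) (by decide)

lemma hasStrongTwoPartition_of_reflTransGen
    (h : ∀ i j : ℤ, Relation.ReflTransGen (crossAdj n S t) (i : ZMod n) (j : ZMod n)) :
    HasStrongTwoPartition (circulantAdj n S) := by
  refine ⟨evenPart n t, (evenPart n t)ᶜ, Set.union_compl_self _, disjoint_compl_right, ?_⟩
  intro u v
  obtain ⟨i, rfl⟩ := ZMod.intCast_surjective u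
  obtain ⟨j, rfl⟩ := ZMod.intCast_surjective v
  exact exists_isPath_of_reflTransGen (h i j)

/-- Steps `1` raise the residue of `t * i` modulo `n` by `t`, and steps `σ` lower it by
`e * n - t * σ`; since these amounts sum to at most `n`, the steps can be ordered so that the
residue never wraps around. -/
lemma reflTransGen_add (hn : 0 < n) (hnt : Even (n + t)) (h1 : 1 ∈ S) {s : ℕ} (hs : s ∈ S)
    {σ e : ℤ} (hσ : (σ : ZMod n) = s) (hodd : Odd (σ + e)) (ht : 0 ≤ t)
    (hD : 0 < e * n - t * σ) (htD : t + (e * n - t * σ) ≤ n) (N : ℕ) :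
    ∀ (a b : ℕ), a + b = N → ∀ i : ℤ, t * (i + a + b * σ) / n = t * i / n + e * b →
      Relation.ReflTransGen (crossAdj n S t) (i : ZMod n) ((i + a + b * σ : ℤ) : ZMod n) := by
  have hn' : (0 : ℤ) < n := by exact_mod_cast hn
  induction N with
  | zero =>
    intro a b hab i _
    obtain ⟨rfl, rfl⟩ : a = 0 ∧ b = 0 := by omega
    simpa using Relation.ReflTransGen.refl
  | succ N ih =>
    intro a b hab i hi
    have key : ∀ y q : ℤ, y / n = q ↔ q * n ≤ y ∧ y < (q + 1) * n := fun y q => by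
      rw [Int.ediv_eq_iff_of_pos hn', add_one_mul]
    obtain ⟨q, hq⟩ : ∃ q, t * i / n = q := ⟨_, rfl⟩
    rw [hq, key] at hi
    have hq' := (key _ _).mp hq
    have up : ∀ a', a = a' + 1 → t * (i + 1) < (q + 1) * n →
        Relation.ReflTransGen (crossAdj n S t) (i : ZMod n)
          ((i + a + b * σ : ℤ) : ZMod n) := by
      rintro a' rfl hlt
      have he : t * (i + 1) / n = q := (key _ _).mpr ⟨by linarith [hq'.1], hlt⟩
      refine .head (crossAdj_succ hn hnt h1 (he.trans hq.symm)) ?_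
      have := ih a' b (by omega) (i + 1) (by
        rw [he, key]
        push_cast at hi
        rw [show i + 1 + (a' : ℤ) = i + (a' + 1) by ring]
        exact hi)
      convert this using 2
      push_cast
      ring
    have down : ∀ b', b = b' + 1 → (q + e) * n ≤ t * (i + σ) →
        Relation.ReflTransGen (crossAdj n S t) (i : ZMod n)
          ((i + a + b * σ : ℤ) : ZMod n) := by
      rintro b' rfl hle
      have he : t * (i + σ) / n = q + e := (key _ _).mpr ⟨hle, by linarith [hq'.2]⟩
      refine .head (crossAdj_of_odd hn hnt hs hσ (he.trans (by rw [hq])) hodd) ?_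
      have := ih a b' (by omega) (i + σ) (by
        rw [he, key]
        push_cast at hi
        rw [show i + σ + (a : ℤ) + b' * σ = i + a + (b' + 1) * σ by ring,
          show q + e + e * (b' : ℤ) = q + e * (b' + 1) by ring]
        exact hi)
      convert this using 2
      push_cast
      ring
    rcases Nat.eq_zero_or_eq_succ_pred a with ha | ha
    · refine down N (by omega) ?_
      subst ha
      obtain rfl : b = N + 1 := by omega
      push_cast at hi
      nlinarith [hi.1, mul_nonneg (Int.natCast_nonneg N) hD.le]
    · rcases Nat.eq_zero_or_eq_succ_pred b with hb | hb
      · refine up _ ha ?_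
        subst hb
        obtain rfl : a = N + 1 := by omega
        push_cast at hi
        nlinarith [hi.2, mul_nonneg (Int.natCast_nonneg N) ht]
      · by_cases hc : (q + e) * n ≤ t * (i + σ)
        · exact down _ hb hc
        · exact up _ ha (by linarith)

lemma hasStrongTwoPartition_of_step (hn : 0 < n) (hnt : Even (n + t)) (h1 : 1 ∈ S) {s : ℕ}
    (hs : s ∈ S) {σ e : ℤ} (hσ : (σ : ZMod n) = s) (hodd : Odd (σ + e)) (ht : 0 < t)
    (hD : 0 < e * n - t * σ) (htD : t + (e * n - t * σ) ≤ n) (het : IsCoprime e t) :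
    HasStrongTwoPartition (circulantAdj n S) := by
  refine hasStrongTwoPartition_of_reflTransGen (t := t) fun i j => ?_
  obtain ⟨x, y, hxy⟩ := het
  obtain ⟨d, hd⟩ : ∃ d, t * j / n - t * i / n = d := ⟨_, rfl⟩
  obtain ⟨m, hb, ha⟩ : ∃ m : ℤ, 0 ≤ x * d + t * m ∧
      0 ≤ j - i - y * d * n - σ * (x * d) + (e * n - t * σ) * m := by
    refine ⟨|x * d| + |j - i - y * d * n - σ * (x * d)|, ?_, ?_⟩
    · nlinarith [neg_abs_le (x * d), abs_nonneg (x * d),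
        abs_nonneg (j - i - y * d * n - σ * (x * d))]
    · nlinarith [neg_abs_le (j - i - y * d * n - σ * (x * d)), abs_nonneg (x * d),
        abs_nonneg (j - i - y * d * n - σ * (x * d))]
  obtain ⟨b, hb⟩ := Int.eq_ofNat_of_zero_le hb
  obtain ⟨a, ha⟩ := Int.eq_ofNat_of_zero_le ha
  have hj : i + a + b * σ = j + n * (e * m - y * d) := by rw [← ha, ← hb]; ring
  have := reflTransGen_add hn hnt h1 hs hσ hodd ht.le hD htD _ a b rfl i (by
    rw [hj, ← hb, show t * (j + n * (e * m - y * d)) = t * j + n * (t * (e * m - y * d)) by ring,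
      Int.add_mul_ediv_left _ _ (by omega)]
    linear_combination hd - d * hxy)
  rw [hj] at this
  simpa using this

lemma hasStrongTwoPartition_of_even (hn : 0 < n) (hev : Even n) (h1 : 1 ∈ S) :
    HasStrongTwoPartition (circulantAdj n S) := by
  refine hasStrongTwoPartition_of_reflTransGen (t := 0) fun i j => ?_
  have reach : ∀ a : ℕ, Relation.ReflTransGen (crossAdj n S 0) (i : ZMod n)
      ((i + a : ℤ) : ZMod n) := by
    intro a
    induction a with
    | zero => simpa using Relation.ReflTransGen.refl
    | succ a ih =>
      have := crossAdj_succ (t := 0) hn (by simpa using hev) h1 (i := i + a) (by simp)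
      refine ih.tail ?_
      rwa [Nat.cast_succ, ← add_assoc]
  obtain ⟨a, ha⟩ := Int.eq_ofNat_of_zero_le
    (Int.emod_nonneg (j - i) (b := n) (by omega))
  have hj : i + a = j + n * (-((j - i) / n)) := by
    linarith [Int.mul_ediv_add_emod (j - i) n]
  have := reach a
  rw [hj] at this
  simpa using this

lemma exists_odd_mul_bounds {n w : ℤ} (hn7 : n ≠ 7) (hn : Odd n) (hw : 3 ≤ w) (hwo : Odd w)
    (hwn : 3 * w ≤ 2 * n) : ∃ t : ℤ, Odd t ∧ 0 < t ∧ t * w < 2 * n ∧ n ≤ t * (w - 1) := by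
  obtain ⟨k, hk⟩ : ∃ k, (2 * n / w - 1) / 2 = k := ⟨_, rfl⟩
  have hw0 : 0 < w := by linarith
  have h3 : 3 ≤ 2 * n / w := (Int.le_ediv_iff_mul_le hw0).mpr hwn
  have hk1 : 1 ≤ k := by omega
  have hlo : (2 * k + 1) * w ≤ 2 * n := (Int.le_ediv_iff_mul_le hw0).mp (by omega)
  have hhi : 2 * n < (2 * k + 3) * w := (Int.ediv_lt_iff_lt_mul hw0).mp (by omega)
  have hto : Odd (2 * k + 1) := ⟨k, rfl⟩
  have hne : (2 * k + 1) * w ≠ 2 * n := by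
    intro h
    have := hto.mul hwo
    rw [h] at this
    exact Int.not_odd_iff_even.mpr (even_two_mul n) this
  refine ⟨2 * k + 1, hto, by omega, lt_of_le_of_ne hlo hne, ?_⟩
  obtain ⟨u, rfl⟩ := hwo
  obtain ⟨v, rfl⟩ := hn
  rcases hk1.eq_or_lt with rfl | hk2
  · omega
  · nlinarith [mul_nonneg (show 0 ≤ k - 2 by omega) (show 0 ≤ u - 1 by omega)]

end PCDigraph

/-- If `n ≥ 3`, `n ≠ 7`, `S ⊆ {1, …, n-1}`, `|S| ≥ 2`, and `1 ∈ S`, then the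
circulant digraph `C_n(S)` has a strong 2-partition. -/
theorem circulant_strongTwoPartition (n : ℕ) (hn : 3 ≤ n) (hn7 : n ≠ 7)
    (S : Finset ℕ) (hS : S ⊆ Finset.Icc 1 (n - 1)) (hScard : 2 ≤ S.card)
    (h1 : 1 ∈ S) :
    HasStrongTwoPartition (circulantAdj n S) := by
  obtain ⟨s, hs, hs1⟩ := Finset.exists_mem_ne (by omega : 1 < S.card) 1
  have hsb := Finset.mem_Icc.mp (hS hs)
  have hn0 : 0 < n := by omega
  rcases Nat.even_or_odd n with hev | hno
  · exact hasStrongTwoPartition_of_even hn0 hev h1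
  have hno' : Odd (n : ℤ) := by exact_mod_cast hno
  have hsn : (s : ℤ) < n := by omega
  rcases Nat.even_or_odd s with hse | hso
  · exact hasStrongTwoPartition_of_step (t := 1) hn0 (hno'.add_odd odd_one) h1 hs
      (σ := s) (e := 1) (by simp) (Even.add_odd (by exact_mod_cast hse) odd_one) one_pos
      (by linarith) (by omega) isCoprime_one_left
  have hso' : Odd (s : ℤ) := by exact_mod_cast hso
  rcases le_or_gt (3 * s) (2 * n) with hle | hgt
  · obtain ⟨t, hto, ht0, hlt, hnt⟩ := exists_odd_mul_bounds (n := n) (w := s) (by omega) hno'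
      (by obtain ⟨k, rfl⟩ := hso; omega) hso' (by omega)
    refine hasStrongTwoPartition_of_step hn0 (hno'.add_odd hto) h1 hs (σ := s) (e := 2)
      (by simp) (hso'.add_even even_two) ht0 (by linarith) (by linarith) ?_
    obtain ⟨k, rfl⟩ := hto
    exact ⟨-k, 1, by ring⟩
  · have hre : Even ((s : ℤ) - n) := hso'.sub_odd hno'
    obtain ⟨t, hto, ht0, hlt, hnt⟩ := exists_odd_mul_bounds (n := n) (w := n - s + 1) (by omega)
      hno' (by obtain ⟨k, hk⟩ := hre; omega) ((hno'.sub_odd hso').add_odd odd_one) (by omega)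
    have hne : (n : ℤ) ≠ t * (n - s + 1 - 1) := by
      intro h
      have : Even (t * ((n : ℤ) - s + 1 - 1)) := by
        rw [add_sub_cancel_right]
        exact (hno'.sub_odd hso').mul_left t
      rw [← h] at this
      exact Int.not_odd_iff_even.mpr this hno'
    have hlt' := lt_of_le_of_ne hnt hne
    exact hasStrongTwoPartition_of_step hn0 (hno'.add_odd hto) h1 hs (σ := s - n) (e := -1)
      (by simp) (hre.add_odd (by decide)) ht0 (by linarith) (by linarith)
      isCoprime_one_left.neg_left
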